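/- arXiv:2304.01790 — 4 statements merged into one kernel-verified Lean document; each statement's English description precedes it below -/
import Mathlib

section
/- Let h ≥ 2, let G = (V,E) be a finite connected unweighted K_h-minor-free simple graph, let s_0, s_1, …, s_{k−1} be a sequence of vertices of G, and let M ⊆ ℤ. For each vertex v ∈ V define X̂_v = {(i,Δ) : 1 ≤ i ≤ k−1, Δ ∈ M, d_G(v,s_i) − d_G(v,s_0) ≤ Δ}, a subset of the ground set {1,…,k−1} × M. Then the family {X̂_v : v ∈ V} has VC dimension at most h−1; that is, every subset of {1,…,k−1} × M shattered by this family has at most h−1 elements. -/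
/-- `G` contains a `K_h`-minor: `h` pairwise disjoint nonempty vertex subsets, each inducing
a connected subgraph, with an edge of `G` between every two of them. -/
def HasCliqueMinor {V : Type*} (G : SimpleGraph V) (h : ℕ) : Prop :=
  ∃ f : Fin h → Set V, (∀ i, (f i).Nonempty) ∧
    (∀ i j, i ≠ j → Disjoint (f i) (f j)) ∧
    (∀ i, (G.induce (f i)).Connected) ∧
    (∀ i j, i ≠ j → ∃ u ∈ f i, ∃ v ∈ f j, G.Adj u v)

/-- A family `F` of subsets of a ground type shatters `Y` if every subset of `Y` is the
intersection of `Y` with a member of `F`. -/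
def Shatters {U : Type*} (F : Set (Set U)) (Y : Set U) : Prop :=
  ∀ Z ⊆ Y, ∃ S ∈ F, Z = S ∩ Y

/-- A set closed under stepping towards `x` induces a connected graph. -/
lemma step_exists {V : Type*} (G : SimpleGraph V) (hconn : G.Connected) (u x : V) (hne : u ≠ x) :
    ∃ w, G.Adj u w ∧ G.dist w x + 1 = G.dist u x := by
  obtain ⟨p, hp⟩ := hconn.exists_walk_length_eq_dist u x
  cases p with
  | nil => exact absurd rfl hne
  | cons hadj q =>
    rename_i w
    refine ⟨w, hadj, ?_⟩
    have h1 := SimpleGraph.dist_le q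
    have h2 : G.dist u x ≤ G.dist u w + G.dist w x := hconn.dist_triangle
    have h3 : G.dist u w = 1 := SimpleGraph.dist_eq_one_iff_adj.2 hadj
    simp only [SimpleGraph.Walk.length_cons] at hp
    omega

lemma adj_dist_le {V : Type*} (G : SimpleGraph V) (hconn : G.Connected) {u w : V}
    (hadj : G.Adj u w) (x : V) : G.dist u x ≤ G.dist w x + 1 := by
  have h2 : G.dist u x ≤ G.dist u w + G.dist w x := hconn.dist_triangle
  have h3 : G.dist u w = 1 := SimpleGraph.dist_eq_one_iff_adj.2 hadj
  omega

lemma closed_mem {V : Type*} (G : SimpleGraph V) (hconn : G.Connected) (x : V) (S : Set V)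
    (hS : ∀ u ∈ S, ∀ w, G.Adj u w → G.dist w x + 1 = G.dist u x → w ∈ S) :
    ∀ n, ∀ u (hu : u ∈ S), G.dist u x = n →
      ∃ hx : x ∈ S, (G.induce S).Reachable ⟨u, hu⟩ ⟨x, hx⟩ := by
  intro n
  induction n with
  | zero =>
    intro u hu h0
    have : u = x := hconn.dist_eq_zero_iff.1 h0
    subst this
    exact ⟨hu, SimpleGraph.Reachable.refl _⟩
  | succ n ih =>
    intro u hu hn
    have hne : u ≠ x := by
      rintro rfl
      simp at hn
    obtain ⟨w, hadj, hw⟩ := step_exists G hconn u x hne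
    have hwS := hS u hu w hadj hw
    obtain ⟨hx, hr⟩ := ih w hwS (by omega)
    refine ⟨hx, SimpleGraph.Reachable.trans (SimpleGraph.Adj.reachable ?_) hr⟩
    exact hadj

/-- Weighted Voronoi cells with ties broken by index. -/
def vcell {V : Type*} (G : SimpleGraph V) {h : ℕ} (x : Fin h → V) (c : Fin h → ℤ) (i : Fin h) :
    Set V :=
  {u | ∀ l, l ≠ i → (G.dist u (x i) : ℤ) - c i < G.dist u (x l) - c l ∨
    ((G.dist u (x i) : ℤ) - c i = G.dist u (x l) - c l ∧ i < l)}

lemma vcell_closed {V : Type*} (G : SimpleGraph V) (hconn : G.Connected) {h : ℕ}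
    (x : Fin h → V) (c : Fin h → ℤ) (i : Fin h) :
    ∀ u ∈ vcell G x c i, ∀ w, G.Adj u w → G.dist w (x i) + 1 = G.dist u (x i) →
      w ∈ vcell G x c i := by
  intro u hu w hadj hw l hl
  have h1 := hu l hl
  have h2 := adj_dist_le G hconn hadj (x l)
  omega

lemma mem_cell_or {V : Type*} (G : SimpleGraph V) {h : ℕ}
    (x : Fin h → V) (c : Fin h → ℤ) (i j : Fin h) (hij : i ≠ j) (u : V)
    (hu : ∀ l, l ≠ i → l ≠ j → (G.dist u (x j) : ℤ) - c j < G.dist u (x l) - c l) :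
    u ∈ vcell G x c i ∨ u ∈ vcell G x c j := by
  by_cases hc : (G.dist u (x i) : ℤ) - c i < G.dist u (x j) - c j ∨
    ((G.dist u (x i) : ℤ) - c i = G.dist u (x j) - c j ∧ i < j)
  · left
    intro l hl
    by_cases hlj : l = j
    · subst hlj; exact hc
    · have := hu l hl hlj
      omega
  · right
    intro l hl
    by_cases hli : l = i
    · subst hli
      omega
    · have := hu l hli hl
      omega

lemma edge_exists {V : Type*} (G : SimpleGraph V) (hconn : G.Connected) {h : ℕ}
    (x : Fin h → V) (c : Fin h → ℤ) (i j : Fin h) (hij : i ≠ j)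
    (hxj : x j ∉ vcell G x c i) :
    ∀ n, ∀ u, G.dist u (x j) = n → u ∈ vcell G x c i →
    (∀ l, l ≠ i → l ≠ j → (G.dist u (x j) : ℤ) - c j < G.dist u (x l) - c l) →
    ∃ a ∈ vcell G x c i, ∃ b ∈ vcell G x c j, G.Adj a b := by
  intro n
  induction n with
  | zero =>
    intro u h0 hu _
    have : u = x j := hconn.dist_eq_zero_iff.1 h0
    subst this
    exact absurd hu hxj
  | succ n ih =>
    intro u hn hu hT
    have hne : u ≠ x j := by
      rintro rfl
      exact hxj hu
    obtain ⟨w, hadj, hw⟩ := step_exists G hconn u (x j) hne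
    have hTw : ∀ l, l ≠ i → l ≠ j →
        (G.dist w (x j) : ℤ) - c j < G.dist w (x l) - c l := by
      intro l h1 h2
      have h3 := hT l h1 h2
      have h4 := adj_dist_le G hconn hadj (x l)
      omega
    rcases mem_cell_or G x c i j hij w hTw with h1 | h1
    · exact ih w (by omega) h1 hTw
    · exact ⟨u, hu, w, h1, hadj⟩

lemma minor_of_sep {V : Type*} (G : SimpleGraph V) (hconn : G.Connected) {h : ℕ}
    (x : Fin h → V) (c : Fin h → ℤ)
    (H : ∀ i j, ∃ v, ∀ l, l ≠ i → l ≠ j →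
      (G.dist v (x i) : ℤ) - c i < G.dist v (x l) - c l ∧
      (G.dist v (x j) : ℤ) - c j < G.dist v (x l) - c l) :
    HasCliqueMinor G h := by
  have hdisj : ∀ i j, i ≠ j → Disjoint (vcell G x c i) (vcell G x c j) := by
    intro i j hij
    rw [Set.disjoint_left]
    intro u hi hj
    have h1 := hi j hij.symm
    have h2 := hj i hij
    omega
  have hx : ∀ i, x i ∈ vcell G x c i := by
    intro i
    obtain ⟨v, hv⟩ := H i i
    have hvm : v ∈ vcell G x c i := fun l hl => Or.inl (hv l hl hl).1
    exact (closed_mem G hconn (x i) _ (vcell_closed G hconn x c i) _ v hvm rfl).1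
  have hnot : ∀ i j, i ≠ j → x j ∉ vcell G x c i := fun i j hij hm =>
    Set.disjoint_left.1 (hdisj i j hij) hm (hx j)
  refine ⟨vcell G x c, fun i => ⟨x i, hx i⟩, hdisj, ?_, ?_⟩
  · intro i
    have : Nonempty (vcell G x c i) := ⟨⟨x i, hx i⟩⟩
    refine ⟨?_⟩
    rintro ⟨a, ha⟩ ⟨b, hb⟩
    obtain ⟨_, h1⟩ := closed_mem G hconn (x i) _ (vcell_closed G hconn x c i) _ a ha rfl
    obtain ⟨_, h2⟩ := closed_mem G hconn (x i) _ (vcell_closed G hconn x c i) _ b hb rfl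
    exact h1.trans h2.symm
  · intro i j hij
    obtain ⟨v, hv⟩ := H i j
    rcases mem_cell_or G x c i j hij v (fun l h1 h2 => (hv l h1 h2).2) with hm | hm
    · exact edge_exists G hconn x c i j hij (hnot i j hij) _ v rfl hm
        (fun l h1 h2 => (hv l h1 h2).2)
    · obtain ⟨a, ha, b, hb, hab⟩ := edge_exists G hconn x c j i hij.symm (hnot j i hij.symm) _ v
        rfl hm (fun l h1 h2 => (hv l h2 h1).1)
      exact ⟨b, hb, a, ha, hab.symm⟩

/-- VC dimension of the family `{X̂_v}` in a connected `K_h`-minor-free graph is at most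
`h - 1`: every shattered subset of the ground set `{1,…,k-1} × M` has at most `h - 1`
elements. -/
theorem vc_dim_LPhat_undirected {V : Type*} [Fintype V] (h k : ℕ) (hh : 2 ≤ h)
    (G : SimpleGraph V) (hconn : G.Connected) (hminor : ¬ HasCliqueMinor G h)
    (s : ℕ → V) (M : Set ℤ) (Y : Set (ℕ × ℤ))
    (hY : Y ⊆ {p : ℕ × ℤ | 1 ≤ p.1 ∧ p.1 ≤ k - 1 ∧ p.2 ∈ M})
    (hshat : Shatters
      {S : Set (ℕ × ℤ) | ∃ v : V,
        S = {p : ℕ × ℤ | 1 ≤ p.1 ∧ p.1 ≤ k - 1 ∧ p.2 ∈ M ∧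
              (G.dist v (s p.1) : ℤ) - (G.dist v (s 0) : ℤ) ≤ p.2}} Y) :
    Y.encard ≤ (h - 1 : ℕ) := by
  by_contra hcon
  have hle : (h : ℕ∞) ≤ Y.encard := by
    have h1 := Order.add_one_le_of_lt (not_le.1 hcon)
    have h2 : (((h - 1 : ℕ) : ℕ∞) + 1) = (h : ℕ∞) := by
      have h3 : h - 1 + 1 = h := by omega
      exact_mod_cast h3
    rwa [h2] at h1
  obtain ⟨t, htY, ht⟩ := Set.exists_subset_encard_eq hle
  have htf : t.Finite := Set.finite_of_encard_eq_coe ht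
  have : Fintype t := htf.fintype
  have hcard : Fintype.card t = h := by
    rw [Set.encard_eq_coe_toFinset_card] at ht
    have := ENat.natCast_inj.1 ht
    rwa [Set.toFinset_card] at this
  let e : Fin h ≃ t := (Fintype.equivFinOfCardEq hcard).symm
  apply hminor
  refine minor_of_sep G hconn (fun i => s (e i).1.1) (fun i => (e i).1.2) ?_
  intro i j
  have hmem : ∀ l, (e l).1 ∈ Y := fun l => htY (e l).2
  obtain ⟨S, ⟨v, rfl⟩, hZ⟩ := hshat {(e i).1, (e j).1} (by
    rintro p (rfl | rfl)
    · exact hmem i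
    · exact hmem j)
  refine ⟨v, fun l hli hlj => ?_⟩
  have hi : (e i).1 ∈ ({(e i).1, (e j).1} : Set (ℕ × ℤ)) := by simp
  have hj : (e j).1 ∈ ({(e i).1, (e j).1} : Set (ℕ × ℤ)) := by simp
  have hl : (e l).1 ∉ ({(e i).1, (e j).1} : Set (ℕ × ℤ)) := by
    rintro (h1 | h1)
    · exact hli (e.injective (Subtype.ext h1))
    · exact hlj (e.injective (Subtype.ext h1))
  rw [hZ] at hi hj hl
  have h1 := hi.1.2.2.2
  have h2 := hj.1.2.2.2
  have h3 : ¬ ((G.dist v (s (e l).1.1) : ℤ) - (G.dist v (s 0) : ℤ) ≤ (e l).1.2) := fun h4 =>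
    hl ⟨⟨(hY (hmem l)).1, (hY (hmem l)).2.1, (hY (hmem l)).2.2, h4⟩, hmem l⟩
  constructor <;> omega
end

section
/- Let h ≥ 2 and let G = (V,E) be a finite connected unweighted K_h-minor-free simple graph. Let W ⊆ V be a nonempty set inducing a connected subgraph H = G[W], and let s_0, s_1, …, s_{b−1} be an enumeration of the boundary ∂H. For each v ∈ V define the pattern p_v ∈ ℤ^b by p_v[i] = d_G(v,s_i) − d_G(v,s_0) for 0 ≤ i ≤ b−1. Then there is a constant c depending only on h such that the number of distinct patterns satisfies |{p_v : v ∈ V}| ≤ c · (b · |W|)^{h−1}. -/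
/-- Every vertex on a shortest walk splits the distance. -/
lemma geodesic_split {V : Type*} {G : SimpleGraph V} (hG : G.Connected) {u v : V}
    (p : G.Walk u v) (hp : p.length = G.dist u v) {y : V} (hy : y ∈ p.support) :
    G.dist u y + G.dist y v = G.dist u v := by
  classical
  have h1 := SimpleGraph.dist_le (p.takeUntil y hy)
  have h2 := SimpleGraph.dist_le (p.dropUntil y hy)
  have h3 : (p.takeUntil y hy).length + (p.dropUntil y hy).length = p.length := by
    rw [← SimpleGraph.Walk.length_append, p.take_spec hy]
  have h4 := hG.dist_triangle (u := u) (v := y) (w := v)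
  omega

/-- If every pair of an additively weighted family of sites can be separated from the others,
the weighted Voronoi cells form a clique minor. -/
lemma minor_of_pairs {V : Type*} (G : SimpleGraph V) (hG : G.Connected) (h : ℕ)
    (s : Fin h → V) (D : Fin h → ℤ)
    (hs : ∀ i j : Fin h, ∃ v : V, ∃ r : ℤ, ∀ k,
      ((G.dist v (s k) : ℤ) - D k ≤ r ↔ (k = i ∨ k = j))) : HasCliqueMinor G h := by
  classical
  let C : Fin h → Set V := fun i => {y | ∀ k,
    (G.dist y (s i) : ℤ) - D i < (G.dist y (s k) : ℤ) - D k ∨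
      ((G.dist y (s i) : ℤ) - D i = (G.dist y (s k) : ℤ) - D k ∧ i ≤ k)}
  have hdisj : ∀ i j, ∀ y, y ∈ C i → y ∈ C j → i = j := by
    intro i j y hi hj
    have h1 := hi j
    have h2 := hj i
    omega
  have hex : ∀ y (i : Fin h), ∃ j, y ∈ C j := by
    intro y i
    obtain ⟨j, -, hj⟩ := Finset.exists_min_image Finset.univ
      (fun k : Fin h => toLex ((G.dist y (s k) : ℤ) - D k, k)) ⟨i, Finset.mem_univ i⟩
    refine ⟨j, fun k => ?_⟩
    have := hj k (Finset.mem_univ k)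
    rw [Prod.Lex.toLex_le_toLex] at this
    exact this
  have htri : ∀ a b c : V, G.dist a c ≤ G.dist a b + G.dist b c :=
    fun a b c => hG.dist_triangle
  -- vertices on the geodesic from a cell to its site stay in the cell
  have hstep : ∀ i y z, y ∈ C i → G.dist y z + G.dist z (s i) = G.dist y (s i) → z ∈ C i := by
    intro i y z hy hz k
    have h1 := hy k
    have h2 := htri y z (s k)
    omega
  -- vertices on the geodesic from the separating vertex are in one of the two cells
  have hpair : ∀ i j v (r : ℤ), (∀ k, ((G.dist v (s k) : ℤ) - D k ≤ r ↔ (k = i ∨ k = j))) →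
      ∀ y, G.dist v y + G.dist y (s i) = G.dist v (s i) → y ∈ C i ∨ y ∈ C j := by
    intro i j v r hv y hy
    obtain ⟨k, hk⟩ := hex y i
    by_cases hki : k = i
    · left; rwa [hki] at hk
    by_cases hkj : k = j
    · right; rwa [hkj] at hk
    exfalso
    have h1 := hk i
    have h2 : ¬ ((G.dist v (s k) : ℤ) - D k ≤ r) := by
      rw [hv k]; tauto
    have h3 := (hv i).2 (Or.inl rfl)
    have h4 := htri v y (s k)
    omega
  have hsite : ∀ i, s i ∈ C i := by
    intro i
    obtain ⟨v, r, hv⟩ := hs i i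
    exact (hpair i i v r hv (s i) (by simp)).elim id id
  refine ⟨C, fun i => ⟨s i, hsite i⟩, ?_, ?_, ?_⟩
  · intro i j hij
    rw [Set.disjoint_left]
    intro y hi hj
    exact hij (hdisj i j y hi hj)
  · intro i
    apply SimpleGraph.induce_connected_of_patches (s i) (hsite i)
    intro y hy
    obtain ⟨p, hp⟩ := hG.exists_walk_length_eq_dist y (s i)
    refine ⟨{z | z ∈ p.support}, ?_, p.end_mem_support, p.start_mem_support,
      p.connected_induce_support _ _⟩
    intro z hz
    exact hstep i y z hy (geodesic_split hG p hp hz)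
  · intro i j hij
    obtain ⟨v, r, hv⟩ := hs i j
    have hv' : ∀ k, ((G.dist v (s k) : ℤ) - D k ≤ r ↔ (k = j ∨ k = i)) := by
      intro k; rw [hv k]; tauto
    obtain ⟨p, hp⟩ := hG.exists_walk_length_eq_dist v (s i)
    obtain ⟨q, hq⟩ := hG.exists_walk_length_eq_dist v (s j)
    have hsup : ∀ y ∈ (p.reverse.append q).support, y ∈ C i ∨ y ∈ C j := by
      intro y hy
      rw [SimpleGraph.Walk.mem_support_append_iff, SimpleGraph.Walk.support_reverse,
        List.mem_reverse] at hy
      rcases hy with hy | hy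
      · exact hpair i j v r hv y (geodesic_split hG p hp hy)
      · exact (hpair j i v r hv' y (geodesic_split hG q hq hy)).symm
    obtain ⟨d, hd, hd1, hd2⟩ := (p.reverse.append q).exists_boundary_dart (C i) (hsite i)
      (fun hj => hij (hdisj i j _ hj (hsite j)))
    refine ⟨d.fst, hd1, d.snd, ?_, d.adj⟩
    rcases hsup d.snd (SimpleGraph.Walk.dart_snd_mem_support_of_mem_darts _ hd) with h1 | h1
    · exact absurd h1 hd2
    · exact h1

/-- Distances inside a connected induced subgraph are less than its number of vertices. -/
lemma dist_lt_of_induce {V : Type*} [Fintype V] (G : SimpleGraph V) (W : Set V)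
    (hW : (G.induce W).Connected) {a b : V} (ha : a ∈ W) (hb : b ∈ W) :
    G.dist a b < W.ncard := by
  classical
  obtain ⟨p, hp, -⟩ := hW.exists_path_of_dist ⟨a, ha⟩ ⟨b, hb⟩
  have h1 := hp.length_lt
  have h2 := SimpleGraph.dist_le (p.map (SimpleGraph.Embedding.induce W).toHom)
  rw [SimpleGraph.Walk.length_map] at h2
  have h3 : Fintype.card W = W.ncard := by
    rw [← Nat.card_eq_fintype_card, Nat.card_coe_set_eq]
  rw [← h3]
  exact lt_of_le_of_lt h2 h1

/-- In a connected `K_h`-minor-free graph, for any connected induced subgraph `G[W]` with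
boundary enumerated by `s : Fin b → V`, the number of distinct patterns
`v ↦ (d(v,s_i) − d(v,s_0))_i` is at most `c · (b·|W|)^{h−1}` for a constant `c = c(h)`. -/
theorem pattern_count_undirected (h : ℕ) (hh : 2 ≤ h) :
    ∃ c : ℕ, ∀ (V : Type) [Fintype V] (G : SimpleGraph V),
      G.Connected → ¬ HasCliqueMinor G h →
      ∀ (W : Set V), W.Nonempty → (G.induce W).Connected →
      ∀ (b : ℕ) (hb : 0 < b) (s : Fin b → V),
        Function.Injective s →
        (∀ i, s i ∈ {w ∈ W | ∃ u ∉ W, G.Adj w u}) →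
        {w ∈ W | ∃ u ∉ W, G.Adj w u} ⊆ Set.range s →
        {f : Fin b → ℤ | ∃ v : V,
            f = fun i => (G.dist v (s i) : ℤ) - (G.dist v (s ⟨0, hb⟩) : ℤ)}.ncard
          ≤ c * (b * W.ncard) ^ (h - 1) := by
  classical
  refine ⟨h * 2 ^ (h - 1), ?_⟩
  intro V _ G hG hminor W hWne hW b hb s hsinj hsb hsrange
  set n := W.ncard with hn
  have hnpos : 0 < n := (Set.ncard_pos (Set.toFinite W)).2 hWne
  set P : V → Fin b → ℤ := fun v i =>
    (G.dist v (s i) : ℤ) - (G.dist v (s ⟨0, hb⟩) : ℤ) with hP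
  have hbound : ∀ v i, -(n : ℤ) < P v i ∧ P v i < n := by
    intro v i
    have h0 := dist_lt_of_induce G W hW (hsb i).1 (hsb ⟨0, hb⟩).1
    have h1 := hG.dist_triangle (u := v) (v := s i) (w := s ⟨0, hb⟩)
    have h2 := hG.dist_triangle (u := v) (v := s ⟨0, hb⟩) (w := s i)
    rw [SimpleGraph.dist_comm (u := s ⟨0, hb⟩)] at h2
    simp only [hP]
    omega
  let F : (Fin b → ℤ) → Finset (Fin b × Fin (2 * n)) := fun f =>
    Finset.univ.filter (fun x => f x.1 ≤ (x.2 : ℤ) - n)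
  let A : Finset (Finset (Fin b × Fin (2 * n))) := Finset.univ.image (fun v => F (P v))
  have hle : ∀ v w : V, F (P v) = F (P w) → ∀ i, P w i ≤ P v i := by
    intro v w hvw i
    have hb1 := hbound v i
    let m : Fin (2 * n) := ⟨(P v i + n).toNat, by omega⟩
    have hm : ((m : ℕ) : ℤ) = P v i + n := by
      show (((P v i + n).toNat : ℕ) : ℤ) = _
      omega
    have hmem : (i, m) ∈ F (P v) := by
      simp only [F, Finset.mem_filter, Finset.mem_univ, true_and]
      omega
    rw [hvw] at hmem
    simp only [F, Finset.mem_filter, Finset.mem_univ, true_and] at hmem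
    omega
  have hcard : {f : Fin b → ℤ | ∃ v : V, f = P v}.ncard ≤ A.card := by
    rw [← Set.ncard_coe_finset]
    refine Set.ncard_le_ncard_of_injOn F ?_ ?_ (Set.toFinite _)
    · rintro f ⟨v, rfl⟩
      simp only [A, Finset.coe_image, Finset.coe_univ, Set.image_univ]
      exact ⟨v, rfl⟩
    · rintro f ⟨v, rfl⟩ g ⟨w, rfl⟩ hfg
      funext i
      exact le_antisymm (hle w v hfg.symm i) (hle v w hfg i)
  have hvc : A.vcDim ≤ h - 1 := by
    refine Finset.sup_le fun T hT => ?_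
    rw [Finset.mem_shatterer] at hT
    by_contra hlt
    obtain ⟨T', hT'sub, hT'card⟩ := Finset.exists_subset_card_eq (show h ≤ T.card by omega)
    have hT' := hT.mono_right hT'sub
    apply hminor
    let e := (T'.equivFinOfCardEq hT'card).symm
    refine minor_of_pairs G hG h (fun k => s (e k).1.1) (fun k => ((e k).1.2 : ℤ) - n) ?_
    intro i j
    obtain ⟨u, hu, hTu⟩ := hT' (t := {(e i).1, (e j).1}) (by
      intro x hx
      rw [Finset.mem_insert, Finset.mem_singleton] at hx
      rcases hx with rfl | rfl
      · exact (e i).2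
      · exact (e j).2)
    obtain ⟨v, -, rfl⟩ := Finset.mem_image.1 hu
    refine ⟨v, (G.dist v (s ⟨0, hb⟩) : ℤ), fun k => ?_⟩
    have h1 : (e k).1 ∈ T' ∩ F (P v) ↔ (e k).1 ∈ ({(e i).1, (e j).1} : Finset _) := by
      rw [hTu]
    rw [Finset.mem_inter, Finset.mem_insert, Finset.mem_singleton, Subtype.coe_inj,
      Subtype.coe_inj, e.injective.eq_iff, e.injective.eq_iff] at h1
    simp only [(e k).2, true_and] at h1
    rw [← h1]
    simp only [F, hP, Finset.mem_filter, Finset.mem_univ, true_and]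
    constructor <;> intro h2 <;> linarith
  have hN : Fintype.card (Fin b × Fin (2 * n)) = b * (2 * n) := by simp
  have hNpos : 0 < b * (2 * n) := by positivity
  calc {f : Fin b → ℤ | ∃ v : V, f = P v}.ncard ≤ A.card := hcard
    _ ≤ A.shatterer.card := A.card_le_card_shatterer
    _ ≤ ∑ k ∈ Finset.Iic A.vcDim, (Fintype.card (Fin b × Fin (2 * n))).choose k :=
        Finset.card_shatterer_le_sum_vcDim
    _ ≤ ∑ k ∈ Finset.Iic A.vcDim, (b * (2 * n)) ^ (h - 1) := by
        refine Finset.sum_le_sum fun k hk => ?_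
        rw [hN]
        refine (Nat.choose_le_pow _ _).trans (Nat.pow_le_pow_right hNpos ?_)
        exact (Finset.mem_Iic.1 hk).trans hvc
    _ = (A.vcDim + 1) * (b * (2 * n)) ^ (h - 1) := by simp
    _ ≤ h * (b * (2 * n)) ^ (h - 1) := Nat.mul_le_mul_right _ (by omega)
    _ = h * 2 ^ (h - 1) * (b * n) ^ (h - 1) := by
        rw [mul_assoc, ← mul_pow]; congr 2; ring
end

section
/- Let G be a finite connected unweighted simple graph, let s_0, s_1, s_2, v_1, v_2, t_1, t_2 be vertices of G, and let Δ_1, Δ_2 ∈ ℤ satisfy: (i) d_G(v_1,t_1) + d_G(t_1,s_1) ≤ Δ_1 + d_G(v_1,s_0); (ii) d_G(v_2,t_2) + d_G(t_2,s_2) ≤ Δ_2 + d_G(v_2,s_0); (iii) d_G(v_1,s_2) > Δ_2 + d_G(v_1,s_0); (iv) d_G(v_2,s_1) > Δ_1 + d_G(v_2,s_0). Then no vertex x satisfies both d_G(t_1,x) + d_G(x,s_1) = d_G(t_1,s_1) and d_G(t_2,x) + d_G(x,s_2) = d_G(t_2,s_2); in other words, every shortest path between t_1 and s_1 is vertex-disjoint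 from every shortest path between t_2 and s_2. -/
/-- Key disjointness claim for the undirected set system `LP-hat`: under conditions
(i)–(iv), every shortest path between `t1` and `s1` is vertex-disjoint from every shortest
path between `t2` and `s2` (a vertex `x` lies on some shortest path between `a` and `b`
iff `d(a,x) + d(x,b) = d(a,b)`). -/
theorem shortest_paths_disjoint_undirected {V : Type*} [Fintype V] (G : SimpleGraph V)
    (hconn : G.Connected) (s0 s1 s2 v1 v2 t1 t2 : V) (Δ1 Δ2 : ℤ)
    (h1 : (G.dist v1 t1 : ℤ) + (G.dist t1 s1 : ℤ) ≤ Δ1 + (G.dist v1 s0 : ℤ))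
    (h2 : (G.dist v2 t2 : ℤ) + (G.dist t2 s2 : ℤ) ≤ Δ2 + (G.dist v2 s0 : ℤ))
    (h3 : Δ2 + (G.dist v1 s0 : ℤ) < (G.dist v1 s2 : ℤ))
    (h4 : Δ1 + (G.dist v2 s0 : ℤ) < (G.dist v2 s1 : ℤ)) :
    ∀ x : V, ¬ (G.dist t1 x + G.dist x s1 = G.dist t1 s1 ∧
                G.dist t2 x + G.dist x s2 = G.dist t2 s2) := by
  rintro x ⟨hx1, hx2⟩
  have a1 := hconn.dist_triangle (u := v1) (v := t1) (w := s2)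
  have a2 := hconn.dist_triangle (u := t1) (v := x) (w := s2)
  have b1 := hconn.dist_triangle (u := v2) (v := t2) (w := s1)
  have b2 := hconn.dist_triangle (u := t2) (v := x) (w := s1)
  omega
end

section
/- Let G be a finite digraph, let s_0, s_i, s_ℓ, t_1, t_2 be vertices with all directed distances appearing below finite, and let Δ_i, Δ_ℓ ∈ ℤ satisfy: (i) d_G(t_1 → s_i) ≤ d_G(t_1 → s_0) + Δ_i; (ii) d_G(t_2 → s_ℓ) ≤ d_G(t_2 → s_0) + Δ_ℓ; (iii) d_G(t_1 → s_ℓ) > d_G(t_1 → s_0) + Δ_ℓ; (iv) d_G(t_2 → s_i) > d_G(t_2 → s_0) + Δ_i. Then no vertex x satisfies both d_G(t_1 → x) + d_G(x → s_i) = d_G(t_1 → s_i) and d_G(t_2 → x) + d_G(x → s_ℓ) = d_G(t_2 → s_ℓ); in other words, every shortest directed path from t_1 to s_i is vertex-disjoint from every shortest directed path from t_2 to s_ℓ. -/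
/-- A directed walk of length `n` from `u` to `v` in the digraph given by arcs `A`. -/
def DWalk {V : Type*} (A : V → V → Prop) (u v : V) (n : ℕ) : Prop :=
  ∃ f : Fin (n + 1) → V, f 0 = u ∧ f (Fin.last n) = v ∧
    ∀ i : Fin n, A (f i.castSucc) (f i.succ)

/-- Directed distance from `u` to `v` (`⊤` if unreachable). -/
noncomputable def ddist {V : Type*} (A : V → V → Prop) (u v : V) : ℕ∞ :=
  sInf {n : ℕ∞ | ∃ m : ℕ, n = m ∧ DWalk A u v m}

theorem DWalk_snoc {V : Type*} {A : V → V → Prop} {u v w : V} {n : ℕ}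
    (h : DWalk A u v n) (hA : A v w) : DWalk A u w (n + 1) := by
  obtain ⟨f, h0, hl, hf⟩ := h
  refine ⟨Fin.snoc (α := fun _ => V) f w, ?_, ?_, ?_⟩
  · have : (0 : Fin (n + 1 + 1)) = Fin.castSucc 0 := rfl
    rw [this, Fin.snoc_castSucc, h0]
  · rw [Fin.snoc_last]
  · intro i
    refine Fin.lastCases ?_ (fun j => ?_) i
    · rw [Fin.succ_last, Fin.snoc_last, Fin.snoc_castSucc, hl]
      exact hA
    · rw [Fin.succ_castSucc, Fin.snoc_castSucc, Fin.snoc_castSucc]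
      exact hf j

theorem DWalk_trans {V : Type*} {A : V → V → Prop} {u v : V} {m : ℕ}
    (h : DWalk A u v m) (n : ℕ) : ∀ w, DWalk A v w n → DWalk A u w (m + n) := by
  induction n with
  | zero =>
    rintro w ⟨g, h0, hl, -⟩
    have : v = w := by rw [← h0, ← hl]; rfl
    exact this ▸ h
  | succ n ih =>
    rintro w ⟨g, h0, hl, hg⟩
    have h1 : DWalk A v (g (Fin.last n).castSucc) n :=
      ⟨fun i => g i.castSucc, h0, rfl, fun i => hg i.castSucc⟩
    have h2 := hg (Fin.last n)
    rw [Fin.succ_last, hl] at h2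
    exact DWalk_snoc (ih _ h1) h2

theorem ddist_walk {V : Type*} {A : V → V → Prop} {u v : V} (h : ddist A u v ≠ ⊤) :
    ∃ m : ℕ, ddist A u v = m ∧ DWalk A u v m := by
  have hne : {n : ℕ∞ | ∃ m : ℕ, n = m ∧ DWalk A u v m}.Nonempty := by
    by_contra hc
    rw [Set.not_nonempty_iff_eq_empty] at hc
    exact h (by rw [ddist, hc, sInf_empty])
  exact csInf_mem hne

theorem ddist_triangle {V : Type*} (A : V → V → Prop) (u v w : V) :
    ddist A u w ≤ ddist A u v + ddist A v w := by
  by_cases h1 : ddist A u v = ⊤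
  · simp [h1]
  by_cases h2 : ddist A v w = ⊤
  · simp [h2]
  obtain ⟨m, hm, wm⟩ := ddist_walk h1
  obtain ⟨n, hn, wn⟩ := ddist_walk h2
  rw [hm, hn]
  exact sInf_le ⟨m + n, by push_cast; rfl, DWalk_trans wm n w wn⟩

/-- Key disjointness claim for the directed set system: under conditions (i)–(iv) every
shortest directed path from `t1` to `si` is vertex-disjoint from every shortest directed
path from `t2` to `sl` (a vertex `x` lies on some shortest directed path from `a` to `b`
iff `d(a→x) + d(x→b) = d(a→b)`). -/
theorem shortest_dipaths_disjoint {V : Type*} [Fintype V] (A : V → V → Prop)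
    (s0 si sl t1 t2 : V) (Δi Δl : ℤ)
    (hf1 : ddist A t1 si ≠ ⊤) (hf2 : ddist A t1 s0 ≠ ⊤) (hf3 : ddist A t1 sl ≠ ⊤)
    (hf4 : ddist A t2 sl ≠ ⊤) (hf5 : ddist A t2 s0 ≠ ⊤) (hf6 : ddist A t2 si ≠ ⊤)
    (h1 : ((ddist A t1 si).toNat : ℤ) ≤ ((ddist A t1 s0).toNat : ℤ) + Δi)
    (h2 : ((ddist A t2 sl).toNat : ℤ) ≤ ((ddist A t2 s0).toNat : ℤ) + Δl)
    (h3 : ((ddist A t1 s0).toNat : ℤ) + Δl < ((ddist A t1 sl).toNat : ℤ))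
    (h4 : ((ddist A t2 s0).toNat : ℤ) + Δi < ((ddist A t2 si).toNat : ℤ)) :
    ∀ x : V, ¬ (ddist A t1 x + ddist A x si = ddist A t1 si ∧
                ddist A t2 x + ddist A x sl = ddist A t2 sl) := by
  rintro x ⟨e1, e2⟩
  have T1 := ddist_triangle A t1 x sl
  have T2 := ddist_triangle A t2 x si
  have a1 : ddist A t1 x ≠ ⊤ := fun h => hf1 (by rw [← e1, h, top_add])
  have a2 : ddist A x si ≠ ⊤ := fun h => hf1 (by rw [← e1, h, add_top])
  have a3 : ddist A t2 x ≠ ⊤ := fun h => hf4 (by rw [← e2, h, top_add])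
  have a4 : ddist A x sl ≠ ⊤ := fun h => hf4 (by rw [← e2, h, add_top])
  generalize ddist A t1 x = p1 at *
  generalize ddist A x si = p2 at *
  generalize ddist A t2 x = p3 at *
  generalize ddist A x sl = p4 at *
  generalize ddist A t1 si = q1 at *
  generalize ddist A t1 s0 = q2 at *
  generalize ddist A t1 sl = q3 at *
  generalize ddist A t2 sl = q4 at *
  generalize ddist A t2 s0 = q5 at *
  generalize ddist A t2 si = q6 at *
  lift p1 to ℕ using a1
  lift p2 to ℕ using a2
  lift p3 to ℕ using a3
  lift p4 to ℕ using a4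
  lift q1 to ℕ using hf1
  lift q2 to ℕ using hf2
  lift q3 to ℕ using hf3
  lift q4 to ℕ using hf4
  lift q5 to ℕ using hf5
  lift q6 to ℕ using hf6
  simp only [ENat.toNat_coe] at h1 h2 h3 h4
  norm_cast at e1 e2 T1 T2
  omega
end
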